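/- arXiv:2306.00703 — 7 statements merged into one kernel-verified Lean document; each statement's English description precedes it below -/
import Mathlib

section
/- Let d ≥ 2, let Γ ∈ 𝒟^d, let P = I − (1/d)𝟙𝟙ᵀ, let Σ = P(−Γ/2)P, and suppose Θ is a d×d real symmetric matrix with Θ𝟙 = 0 and ΘΣ = P (i.e. Θ is the Moore–Penrose pseudoinverse of Σ). Set ξ = (Σ_11, …, Σ_dd)ᵀ ∈ ℝ^d, r = (1/2)Θξ + (1/d)𝟙, and R² = (1/2)ξᵀ(r + (1/d)𝟙). Then the Cayley–Menger matrix CM(Γ) is invertible and its inverse equals the (d+1)×(d+1) block matrix [[Θ, −r], [rᵀ, −R²]]. -/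
open Matrix

noncomputable section

/-- The Cayley–Menger matrix of a `d × d` matrix `Γ`: the `(d+1) × (d+1)` block matrix
`[[-Γ/2, 𝟙], [-𝟙ᵀ, 0]]`. -/
def CM {d : ℕ} (Γ : Matrix (Fin d) (Fin d) ℝ) :
    Matrix (Fin (d + 1)) (Fin (d + 1)) ℝ :=
  Matrix.of fun i j =>
    if hi : (i : ℕ) < d then
      if hj : (j : ℕ) < d then -Γ ⟨i, hi⟩ ⟨j, hj⟩ / 2 else 1
    else if (j : ℕ) < d then -1 else 0

/-- The projection matrix `P = I - (1/d) 𝟙𝟙ᵀ`. -/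
def projP (d : ℕ) : Matrix (Fin d) (Fin d) ℝ :=
  1 - ((d : ℝ)⁻¹) • Matrix.vecMulVec 1 1

/-- The claimed inverse of the Cayley–Menger matrix: the block matrix
`[[Θ, -r], [rᵀ, -R²]]` where `ξ = diag Σ`, `r = (1/2)Θξ + (1/d)𝟙` and
`R² = (1/2) ξᵀ (r + (1/d)𝟙)`. -/
def cmBlockInv {d : ℕ} (Θ S : Matrix (Fin d) (Fin d) ℝ) :
    Matrix (Fin (d + 1)) (Fin (d + 1)) ℝ :=
  let ξ : Fin d → ℝ := fun i => S i i
  let r : Fin d → ℝ := (1 / 2 : ℝ) • (Θ *ᵥ ξ) + ((d : ℝ)⁻¹) • (1 : Fin d → ℝ)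
  let R2 : ℝ := (1 / 2 : ℝ) * (ξ ⬝ᵥ (r + ((d : ℝ)⁻¹) • (1 : Fin d → ℝ)))
  Matrix.of fun i j =>
    if hi : (i : ℕ) < d then
      if hj : (j : ℕ) < d then Θ ⟨i, hi⟩ ⟨j, hj⟩ else -r ⟨i, hi⟩
    else if hj : (j : ℕ) < d then r ⟨j, hj⟩ else -R2

lemma projP_mul_apply {d : ℕ} (M : Matrix (Fin d) (Fin d) ℝ) (i j : Fin d) :
    (projP d * M) i j = M i j - (d : ℝ)⁻¹ * ∑ k, M k j := by
  simp [projP, Matrix.mul_apply, Matrix.one_apply, sub_mul, Finset.mul_sum]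

lemma mul_projP_apply {d : ℕ} (M : Matrix (Fin d) (Fin d) ℝ) (i j : Fin d) :
    (M * projP d) i j = M i j - (d : ℝ)⁻¹ * ∑ k, M i k := by
  simp [projP, Matrix.mul_apply, Matrix.one_apply, mul_sub, ← Finset.sum_mul, mul_comm]

lemma projP_isSymm (d : ℕ) : (projP d).IsSymm := by
  ext i j
  simp [projP, Matrix.one_apply, eq_comm]

lemma projP_mulVec_apply {d : ℕ} (v : Fin d → ℝ) (i : Fin d) :
    (projP d *ᵥ v) i = v i - (d : ℝ)⁻¹ * ∑ k, v k := by
  simp [projP, Matrix.mulVec, dotProduct, Matrix.one_apply, sub_mul, Finset.mul_sum]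

/-- A symmetric matrix with zero diagonal is recovered from its double centering. -/
lemma apply_eq_of_eq_projP_mul_mul_projP {d : ℕ} {A S : Matrix (Fin d) (Fin d) ℝ}
    (hA : A.IsSymm) (hdiag : ∀ i, A i i = 0) (hS : S = projP d * A * projP d) (i j : Fin d) :
    A i j = S i j - (S i i + S j j) / 2 := by
  have hcol (i : Fin d) : ∑ k, A k i = ∑ k, A i k :=
    Finset.sum_congr rfl fun k _ => hA.apply i k
  simp only [hS, mul_projP_apply, projP_mul_apply, hdiag, hcol, Finset.sum_sub_distrib,
    ← Finset.mul_sum]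
  ring

lemma projP_mulVec_one {d : ℕ} (hd : d ≠ 0) : projP d *ᵥ (1 : Fin d → ℝ) = 0 := by
  ext i
  simp [projP_mulVec_apply, hd]

lemma CM_mul_cmBlockInv {d : ℕ} (hd : d ≠ 0) {Γ Θ S : Matrix (Fin d) (Fin d) ℝ}
    (hΓsym : Γ.IsSymm) (hΓdiag : ∀ i, Γ i i = 0)
    (hS : S = projP d * ((-(1 / 2) : ℝ) • Γ) * projP d)
    (hΘsym : Θ.IsSymm) (hΘ1 : Θ *ᵥ (1 : Fin d → ℝ) = 0) (hΘS : Θ * S = projP d) :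
    CM Γ * cmBlockInv Θ S = 1 := by
  have hd' : (d : ℝ) ≠ 0 := by exact_mod_cast hd
  have hA (i j : Fin d) : -Γ i j / 2 = S i j - (S i i + S j j) / 2 := by
    rw [← apply_eq_of_eq_projP_mul_mul_projP (hΓsym.smul _) (by simp [hΓdiag]) hS i j]
    simp
    ring
  have hSsym : S.IsSymm := by
    rw [hS, Matrix.IsSymm, Matrix.transpose_mul, Matrix.transpose_mul, (projP_isSymm d).eq,
      (hΓsym.smul _).eq, Matrix.mul_assoc]
  have hSΘ : S * Θ = projP d := by
    rw [← (projP_isSymm d).eq, ← hΘS, Matrix.transpose_mul, hSsym.eq, hΘsym.eq]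
  have hS1 : S *ᵥ (1 : Fin d → ℝ) = 0 := by
    rw [hS, ← Matrix.mulVec_mulVec, projP_mulVec_one hd, Matrix.mulVec_zero]
  set ξ : Fin d → ℝ := fun i => S i i with hξ
  set r : Fin d → ℝ := (1 / 2 : ℝ) • (Θ *ᵥ ξ) + ((d : ℝ)⁻¹) • (1 : Fin d → ℝ) with hr
  have hrow (i : Fin d) : ∑ k, Θ i k = 0 := by
    simpa [Matrix.mulVec, dotProduct] using congrFun hΘ1 i
  have hcol (j : Fin d) : ∑ k, Θ k j = 0 := by
    rw [← hrow j]
    exact Finset.sum_congr rfl fun k _ => hΘsym.apply j k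
  have hξΘ (j : Fin d) : ∑ k, ξ k * Θ k j = (Θ *ᵥ ξ) j :=
    Finset.sum_congr rfl fun k _ => by rw [hΘsym.apply j k, mul_comm]
  have hsum : ∑ k, r k = 1 := by
    have h : ∑ k, (Θ *ᵥ ξ) k = 0 := by
      simp only [Matrix.mulVec, dotProduct]
      rw [Finset.sum_comm]
      simp [← Finset.sum_mul, hcol]
    simp [hr, Finset.sum_add_distrib, ← Finset.mul_sum, h, hd']
  have hSr (i : Fin d) : ∑ k, S i k * r k = (ξ i - (d : ℝ)⁻¹ * ∑ k, ξ k) / 2 := by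
    have h : (S *ᵥ r) i = (ξ i - (d : ℝ)⁻¹ * ∑ k, ξ k) / 2 := by
      rw [hr, Matrix.mulVec_add, Matrix.mulVec_smul, Matrix.mulVec_smul, Matrix.mulVec_mulVec,
        hSΘ, hS1]
      simp only [smul_zero, add_zero, Pi.smul_apply, projP_mulVec_apply, smul_eq_mul]
      ring
    exact h
  ext i j
  rw [Matrix.mul_apply, Fin.sum_univ_castSucc]
  induction i using Fin.lastCases with
  | last =>
    induction j using Fin.lastCases with
    | last => simpa [CM, cmBlockInv, ← hξ, hr] using hsum
    | cast j => simp [CM, cmBlockInv, hcol, Fin.ext_iff, j.isLt.ne']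
  | cast i =>
    induction j using Fin.lastCases with
    | last =>
      have h : ∑ k, -Γ i k / 2 * r k
          = ∑ k, S i k * r k - ξ i / 2 * ∑ k, r k - (∑ k, ξ k * r k) / 2 := by
        rw [Finset.mul_sum, Finset.sum_div, ← Finset.sum_sub_distrib, ← Finset.sum_sub_distrib]
        refine Finset.sum_congr rfl fun k _ => ?_
        rw [hA]
        ring
      have h2 : ξ ⬝ᵥ (r + (d : ℝ)⁻¹ • (1 : Fin d → ℝ))
          = ∑ k, ξ k * r k + (d : ℝ)⁻¹ * ∑ k, ξ k := by
        simp [dotProduct, mul_add, Finset.sum_add_distrib, Finset.mul_sum, mul_comm]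
      have h3 : (1 : Matrix (Fin (d + 1)) (Fin (d + 1)) ℝ) i.castSucc (Fin.last d) = 0 :=
        Matrix.one_apply_ne (Fin.castSucc_lt_last i).ne
      rw [h3]
      simp only [CM, cmBlockInv, ← hξ, ← hr, h2, Matrix.of_apply, Fin.val_castSucc, Fin.is_lt,
        Fin.val_last, lt_irrefl, dite_true, dite_false, Fin.eta, mul_neg, Finset.sum_neg_distrib,
        one_mul]
      rw [h, hSr, hsum]
      ring
    | cast j =>
      have h : ∑ k, -Γ i k / 2 * Θ k j
          = (S * Θ) i j - ξ i / 2 * ∑ k, Θ k j - (∑ k, ξ k * Θ k j) / 2 := by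
        rw [Matrix.mul_apply, Finset.mul_sum, Finset.sum_div, ← Finset.sum_sub_distrib,
          ← Finset.sum_sub_distrib]
        refine Finset.sum_congr rfl fun k _ => ?_
        rw [hA]
        ring
      have h3 : (1 : Matrix (Fin (d + 1)) (Fin (d + 1)) ℝ) i.castSucc j.castSucc
          = (1 : Matrix (Fin d) (Fin d) ℝ) i j := by
        simp [Matrix.one_apply]
      rw [h3]
      simp only [CM, cmBlockInv, ← hξ, ← hr, Matrix.of_apply, Fin.val_castSucc, Fin.is_lt,
        Fin.val_last, lt_irrefl, dite_true, dite_false, Fin.eta, one_mul]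
      rw [h, hSΘ, hcol, hξΘ, hr]
      simp [projP]
      ring

/-- for `Γ ∈ 𝒟^d`, with `Σ = P(-Γ/2)P` and `Θ` the Moore–Penrose
pseudoinverse of `Σ` (symmetric, `Θ𝟙 = 0`, `ΘΣ = P`), the Cayley–Menger matrix `CM Γ`
is invertible with inverse the block matrix `[[Θ, -r], [rᵀ, -R²]]`. -/
theorem statement0 {d : ℕ} (hd : 2 ≤ d)
    (Γ Θ S : Matrix (Fin d) (Fin d) ℝ)
    (hΓsym : Γ.IsSymm) (hΓdiag : ∀ i, Γ i i = 0)
    (hΓneg : ∀ x : Fin d → ℝ, x ≠ 0 → (∑ i, x i) = 0 → x ⬝ᵥ (Γ *ᵥ x) < 0)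
    (hS : S = projP d * ((-(1 / 2) : ℝ) • Γ) * projP d)
    (hΘsym : Θ.IsSymm) (hΘ1 : Θ *ᵥ (1 : Fin d → ℝ) = 0)
    (hΘS : Θ * S = projP d) :
    IsUnit (CM Γ) ∧ (CM Γ)⁻¹ = cmBlockInv Θ S := by
  have h := CM_mul_cmBlockInv (by omega) hΓsym hΓdiag hS hΘsym hΘ1 hΘS
  exact ⟨IsUnit.of_mul_eq_one _ h, Matrix.inv_eq_right_inv h⟩
end
end

section
/- Let d ≥ 2 and let Γ ∈ 𝒟^d. Then for every k ∈ {1,…,d}, det(CM(Γ)) = det(Σ^(k)); in particular, det(Σ^(k)) takes the same value for all k, and det(CM(Γ)) ≠ 0. -/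
open Matrix

noncomputable section

/-- The Farris transform `Σ^(k)` of `Γ`: the `(d-1) × (d-1)` matrix indexed by
`{1,…,d} \ {k}` with entries `Σ^(k)_{ij} = (Γ_{ik} + Γ_{jk} - Γ_{ij})/2`. -/
def farris {d : ℕ} (Γ : Matrix (Fin d) (Fin d) ℝ) (k : Fin d) :
    Matrix {i : Fin d // i ≠ k} {i : Fin d // i ≠ k} ℝ :=
  Matrix.of fun i j =>
    (Γ (i : Fin d) k + Γ (j : Fin d) k - Γ (i : Fin d) (j : Fin d)) / 2

@[simp]
lemma CM_castSucc_castSucc {d : ℕ} (Γ : Matrix (Fin d) (Fin d) ℝ) (i j : Fin d) :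
    CM Γ i.castSucc j.castSucc = -Γ i j / 2 := by
  simp [CM]

@[simp]
lemma CM_castSucc_last {d : ℕ} (Γ : Matrix (Fin d) (Fin d) ℝ) (i : Fin d) :
    CM Γ i.castSucc (Fin.last d) = 1 := by
  simp [CM]

@[simp]
lemma CM_last_castSucc {d : ℕ} (Γ : Matrix (Fin d) (Fin d) ℝ) (j : Fin d) :
    CM Γ (Fin.last d) j.castSucc = -1 := by
  simp [CM]

@[simp]
lemma CM_last_last {d : ℕ} (Γ : Matrix (Fin d) (Fin d) ℝ) :
    CM Γ (Fin.last d) (Fin.last d) = 0 := by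
  simp [CM]

/-- The index set of the Cayley–Menger matrix, with `k` and the border index split off. -/
def splitIndexEquiv {d : ℕ} (k : Fin d) : {i : Fin d // i ≠ k} ⊕ Fin 2 ≃ Fin (d + 1) :=
  Equiv.ofBijective (Sum.elim (fun i => i.1.castSucc) ![k.castSucc, Fin.last d]) <| by
    rw [Fintype.bijective_iff_injective_and_card]
    constructor
    · rintro (⟨i, hi⟩ | i) (⟨j, hj⟩ | j) h
      · simpa using h
      · fin_cases j
        · exact absurd (by simpa using h) hi
        · simp [Fin.castSucc_ne_last] at h
      · fin_cases i
        · exact absurd (by simpa using h.symm) hj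
        · simp [(Fin.castSucc_ne_last _).symm] at h
      · fin_cases i <;> fin_cases j <;>
          simp_all [Fin.castSucc_ne_last, (Fin.castSucc_ne_last _).symm]
    · have := k.pos
      simp [Fintype.card_subtype_compl]
      omega

/-- The determinant of the Cayley–Menger matrix is that of any Farris transform: the latter is
the Schur complement of the block on the rows and columns `k` and `d + 1`. -/
lemma det_CM_eq_det_farris {d : ℕ} {Γ : Matrix (Fin d) (Fin d) ℝ} (hsym : Γ.IsSymm)
    (hdiag : ∀ i, Γ i i = 0) (k : Fin d) : (CM Γ).det = (farris Γ k).det := by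
  let A : Matrix {i : Fin d // i ≠ k} {i : Fin d // i ≠ k} ℝ := of fun i j => -Γ i j / 2
  let B : Matrix {i : Fin d // i ≠ k} (Fin 2) ℝ := of fun i => ![-Γ i k / 2, 1]
  let C : Matrix (Fin 2) {i : Fin d // i ≠ k} ℝ := of ![fun j => -Γ k j / 2, fun _ => -1]
  let D : Matrix (Fin 2) (Fin 2) ℝ := !![0, 1; -1, 0]
  let D' : Matrix (Fin 2) (Fin 2) ℝ := !![0, -1; 1, 0]
  have hblock : (CM Γ).submatrix (splitIndexEquiv k) (splitIndexEquiv k) =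
      fromBlocks A B C D := by
    ext (i | i) (j | j)
    · simp [splitIndexEquiv, A]
    · fin_cases j <;> simp [splitIndexEquiv, B]
    · fin_cases i <;> simp [splitIndexEquiv, C]
    · fin_cases i <;> fin_cases j <;> simp [splitIndexEquiv, D, hdiag]
  let _ : Invertible D := ⟨D', by simp [D, D', one_fin_two], by simp [D, D', one_fin_two]⟩
  have hschur : A - B * ⅟D * C = farris Γ k := by
    change A - B * D' * C = farris Γ k
    ext i j
    simp [A, B, C, D', farris, Matrix.mul_apply, Fin.sum_univ_two, hsym.apply k j]
    ring
  rw [← det_submatrix_equiv_self (splitIndexEquiv k), hblock, det_fromBlocks₂₂, hschur]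
  simp [D, det_fin_two]

/-- The Cayley–Menger matrix of a strictly conditionally negative definite matrix is
nonsingular. -/
lemma det_CM_ne_zero {d : ℕ} (hd : 0 < d) {Γ : Matrix (Fin d) (Fin d) ℝ}
    (hneg : ∀ x : Fin d → ℝ, x ≠ 0 → (∑ i, x i) = 0 → x ⬝ᵥ (Γ *ᵥ x) < 0) :
    (CM Γ).det ≠ 0 := by
  intro hdet
  obtain ⟨v, hv, hCMv⟩ := exists_mulVec_eq_zero_iff.mpr hdet
  let x : Fin d → ℝ := fun i => v i.castSucc
  have hsum : ∑ i, x i = 0 := by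
    have h := congrFun hCMv (Fin.last d)
    simpa [mulVec, dotProduct, Fin.sum_univ_castSucc] using h
  have hrow (i : Fin d) : (Γ *ᵥ x) i = 2 * v (Fin.last d) := by
    have h := congrFun hCMv i.castSucc
    simp only [mulVec, dotProduct, Fin.sum_univ_castSucc, CM_castSucc_castSucc,
      CM_castSucc_last, Pi.zero_apply, one_mul] at h
    have hscale : ∑ j, -Γ i j / 2 * v j.castSucc = -(Γ *ᵥ x) i / 2 := by
      simp only [mulVec, dotProduct, x, ← Finset.sum_neg_distrib, Finset.sum_div]
      exact Finset.sum_congr rfl fun j _ => by ring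
    linarith
  have hquad : x ⬝ᵥ (Γ *ᵥ x) = 0 := by
    simp only [dotProduct, hrow, ← Finset.sum_mul, hsum, zero_mul]
  have hx : x = 0 := by
    by_contra hx
    exact (hneg x hx hsum).ne hquad
  have hlast : v (Fin.last d) = 0 := by
    have h := hrow ⟨0, hd⟩
    simpa [hx] using h
  exact hv (funext fun i => Fin.lastCases hlast (fun j => congrFun hx j) i)

/-- for `Γ ∈ 𝒟^d`, `det (CM Γ) = det (Σ^(k))` for every `k`, and
`det (CM Γ) ≠ 0`. -/
theorem statement1 {d : ℕ} (hd : 2 ≤ d)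
    (Γ : Matrix (Fin d) (Fin d) ℝ)
    (hΓsym : Γ.IsSymm) (hΓdiag : ∀ i, Γ i i = 0)
    (hΓneg : ∀ x : Fin d → ℝ, x ≠ 0 → (∑ i, x i) = 0 → x ⬝ᵥ (Γ *ᵥ x) < 0) :
    ∀ k : Fin d, (CM Γ).det = (farris Γ k).det ∧ (CM Γ).det ≠ 0 :=
  fun k => ⟨det_CM_eq_det_farris hΓsym hΓdiag k, det_CM_ne_zero (by omega) hΓneg⟩
end
end

section
/- Let d ≥ 2, let Γ ∈ 𝒟^d, let k ∈ {1,…,d}, and let i, j ∈ {1,…,d} with i ≠ j, i ≠ k, j ≠ k, and let C ⊆ {1,…,d}∖{i,j,k}, written C = {c₁ < ⋯ < c_m}. Then det of the submatrix of the Farris transform Σ^(k) with rows indexed in order by (i, c₁, …, c_m) and columns indexed in order by (j, c₁, …, c_m) equals det of the submatrix of CM(Γ) with rows indexed in order by (i, k, c₁, …, c_m, d+1) and columns indexed in order by (j, k, c₁, …, c_m, d+1). -/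
open Matrix

noncomputable section

/-- Expanding a Cayley–Menger submatrix along the rows and columns `k` and `d + 1`: its
determinant is that of the corresponding Schur complement. -/
theorem det_CM_submatrix {d : ℕ} (Γ : Matrix (Fin d) (Fin d) ℝ) (hΓdiag : ∀ i, Γ i i = 0)
    (k : Fin d) {ι : Type*} [Fintype ι] [DecidableEq ι] (f g : ι → Fin d) :
    ((CM Γ).submatrix
        (Sum.elim (fun a => Fin.castSucc (f a))
          (Sum.elim (fun _ : Unit => Fin.castSucc k) (fun _ : Unit => Fin.last d)))
        (Sum.elim (fun a => Fin.castSucc (g a))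
          (Sum.elim (fun _ : Unit => Fin.castSucc k) (fun _ : Unit => Fin.last d)))).det =
      (Matrix.of fun a b => (Γ (f a) k + Γ k (g b) - Γ (f a) (g b)) / 2).det := by
  let D : Matrix (Unit ⊕ Unit) (Unit ⊕ Unit) ℝ := fromBlocks 0 1 (-1) 0
  let _ : Invertible D :=
    ⟨fromBlocks 0 (-1) 1 0, by simp [D, fromBlocks_multiply], by simp [D, fromBlocks_multiply]⟩
  have hinv : ⅟D = fromBlocks 0 (-1) 1 0 := rfl
  have hdet : D.det = 1 := by
    let e : Unit ⊕ Unit ≃ Fin 2 :=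
      (Equiv.sumCongr finOneEquiv.symm finOneEquiv.symm).trans finSumFinEquiv
    have hD : D = (!![0, 1; -1, 0] : Matrix (Fin 2) (Fin 2) ℝ).submatrix e e := by
      ext (a | a) (b | b) <;> simp [D, e, finOneEquiv] <;> rfl
    rw [hD, det_submatrix_equiv_self, det_fin_two_of]
    norm_num
  have hblocks : (CM Γ).submatrix
        (Sum.elim (fun a => Fin.castSucc (f a))
          (Sum.elim (fun _ : Unit => Fin.castSucc k) (fun _ : Unit => Fin.last d)))
        (Sum.elim (fun a => Fin.castSucc (g a))
          (Sum.elim (fun _ : Unit => Fin.castSucc k) (fun _ : Unit => Fin.last d))) =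
      fromBlocks (Matrix.of fun a b => -Γ (f a) (g b) / 2)
        (Matrix.of fun a => Sum.elim (fun _ => -Γ (f a) k / 2) (fun _ => 1))
        (Matrix.of fun s b => Sum.elim (fun _ => -Γ k (g b) / 2) (fun _ => -1) s) D := by
    ext (a | a | a) (b | b | b) <;> simp [CM, D, hΓdiag]
  rw [hblocks, det_fromBlocks₂₂, hdet, one_mul, hinv]
  congr 1
  ext a b
  simp [Matrix.mul_apply, Fintype.sum_sum_type]
  ring

/-- for `Γ ∈ 𝒟^d`, distinct `i, j, k` and `C ⊆ {1,…,d} \ {i,j,k}`,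
the determinant of the submatrix of the Farris transform `Σ^(k)` with rows `(i, C)`
and columns `(j, C)` equals the determinant of the submatrix of `CM Γ` with rows
`(i, k, C, d+1)` and columns `(j, k, C, d+1)` (both submatrices being indexed so that
the rows and columns are listed in the same order, which determines the determinants
uniquely). -/
theorem statement3 {d : ℕ} (hd : 2 ≤ d)
    (Γ : Matrix (Fin d) (Fin d) ℝ)
    (hΓsym : Γ.IsSymm) (hΓdiag : ∀ i, Γ i i = 0)
    (hΓneg : ∀ x : Fin d → ℝ, x ≠ 0 → (∑ i, x i) = 0 → x ⬝ᵥ (Γ *ᵥ x) < 0)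
    (k i j : Fin d) (hij : i ≠ j) (hik : i ≠ k) (hjk : j ≠ k)
    (C : Finset (Fin d)) (hiC : i ∉ C) (hjC : j ∉ C) (hkC : k ∉ C) :
    ((farris Γ k).submatrix
        (Sum.elim (fun _ : Unit => (⟨i, hik⟩ : {x : Fin d // x ≠ k}))
          (fun c : {x : Fin d // x ∈ C} =>
            (⟨c.1, fun h => hkC (h ▸ c.2)⟩ : {x : Fin d // x ≠ k})))
        (Sum.elim (fun _ : Unit => (⟨j, hjk⟩ : {x : Fin d // x ≠ k}))
          (fun c : {x : Fin d // x ∈ C} =>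
            (⟨c.1, fun h => hkC (h ▸ c.2)⟩ : {x : Fin d // x ≠ k})))).det
    = ((CM Γ).submatrix
        (Sum.elim
          (Sum.elim (fun _ : Unit => Fin.castSucc i)
            (fun c : {x : Fin d // x ∈ C} => Fin.castSucc c.1))
          (Sum.elim (fun _ : Unit => Fin.castSucc k) (fun _ : Unit => Fin.last d)))
        (Sum.elim
          (Sum.elim (fun _ : Unit => Fin.castSucc j)
            (fun c : {x : Fin d // x ∈ C} => Fin.castSucc c.1))
          (Sum.elim (fun _ : Unit => Fin.castSucc k) (fun _ : Unit => Fin.last d)))).det := by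
  have hsum : ∀ x : Fin d, Sum.elim (fun _ : Unit => Fin.castSucc x)
      (fun c : {x : Fin d // x ∈ C} => Fin.castSucc c.1) =
      fun a => Fin.castSucc (Sum.elim (fun _ : Unit => x) Subtype.val a) := by
    intro x
    ext (a | a) <;> rfl
  rw [hsum i, hsum j, det_CM_submatrix Γ hΓdiag]
  congr 1
  ext (a | a) (b | b) <;> simp [farris, hΓsym.apply]
end
end

section
/- Let G = (V, E) be a connected finite simple graph on V = {1,…,d} with d ≥ 2, let Q be a d×d real symmetric matrix with zero diagonal such that Q_{uv} = 0 whenever uv ∉ E, and let Θ = D − Q be the associated signed Laplacian. Assume Θ has rank d−1, let Σ be its Moore–Penrose pseudoinverse and Γ the variogram of Σ. Let 𝒯 denote the set of spanning trees of G and, for distinct i, j ∈ V, let ℱ_{ij} denote the set of spanning forests F of G having exactly two connected components such that i and j lie in different components of F. Then Σ_{T∈𝒯} Π_{st∈T} Q_{st} ≠ 0 and, for all distinct i, j ∈ V, Γ_{ij} = (Σ_{F∈ℱ_{ij}} Π_{st∈F} Q_{st}) / (Σ_{T∈𝒯} Π_{st∈T} Q_{st}). -/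
open Matrix

noncomputable section

/-- The signed Laplacian `Θ = D - Q` of a symmetric weight matrix `Q` with zero
diagonal, where `D` is diagonal with `D_{ii} = ∑_{j ≠ i} Q_{ij}`. -/
def signedLap {d : ℕ} (Q : Matrix (Fin d) (Fin d) ℝ) : Matrix (Fin d) (Fin d) ℝ :=
  Matrix.diagonal (fun i => ∑ j ∈ Finset.univ.erase i, Q i j) - Q

/-- An edge set `T ⊆ Sym2 V` of edges of `G` is a spanning tree of `G` if the graph it
spans is connected and acyclic. -/
def IsSpanningTreeOf {d : ℕ} (G : SimpleGraph (Fin d)) (T : Finset (Sym2 (Fin d))) : Prop :=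
  ↑T ⊆ G.edgeSet ∧ (SimpleGraph.fromEdgeSet (↑T : Set (Sym2 (Fin d)))).Connected ∧
    (SimpleGraph.fromEdgeSet (↑T : Set (Sym2 (Fin d)))).IsAcyclic

/-- An edge set `F ⊆ Sym2 V` of edges of `G` is a two-component spanning forest of `G`
separating `i` and `j` if the graph it spans is acyclic, has exactly two connected
components, and `i` and `j` are not reachable from one another. -/
def IsTwoForestOf {d : ℕ} (G : SimpleGraph (Fin d)) (F : Finset (Sym2 (Fin d)))
    (i j : Fin d) : Prop :=
  ↑F ⊆ G.edgeSet ∧ (SimpleGraph.fromEdgeSet (↑F : Set (Sym2 (Fin d)))).IsAcyclic ∧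
    (∃ c₁ c₂ : (SimpleGraph.fromEdgeSet (↑F : Set (Sym2 (Fin d)))).ConnectedComponent,
      c₁ ≠ c₂ ∧ ∀ c, c = c₁ ∨ c = c₂) ∧
    ¬ (SimpleGraph.fromEdgeSet (↑F : Set (Sym2 (Fin d)))).Reachable i j

open scoped Classical

namespace MatrixForest

variable {V K : Type*} [Fintype V] [DecidableEq V] [CommRing K]

/-- The weighted Laplacian of `Q` with the rows indexed by `R` replaced by those of the identity. -/
def groundedLap (R : Finset V) (Q : Matrix V V K) : Matrix V V K := fun i =>
  if i ∈ R then Pi.single i 1 else ∑ k, Q i k • (Pi.single i 1 - Pi.single k 1)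

/-- The matrix with rows `e i` for `i ∈ R` and `e i - e (f i)` for `i ∉ R`. -/
def functionalLap (K : Type*) [CommRing K] (R : Finset V) (f : V → V) : Matrix V V K := fun i =>
  if i ∈ R then Pi.single i 1 else Pi.single i 1 - Pi.single (f i) 1

/-- Iterating `f` strictly decreases some height as long as one is outside of `R`. -/
def IsRooted (R : Finset V) (f : V → V) : Prop :=
  ∃ h : V → ℕ, ∀ i ∉ R, h (f i) < h i

/-- The edges `s(i, f i)` for `i ∉ R`. -/
def edgesOf (R : Finset V) (f : V → V) : Finset (Sym2 V) :=
  Rᶜ.image fun i => s(i, f i)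

/-- A set of edges of the right cardinality connecting every vertex to `R`. -/
def IsRootedForest (R : Finset V) (T : Finset (Sym2 V)) : Prop :=
  (∀ e ∈ T, ¬ e.IsDiag) ∧ T.card + R.card = Fintype.card V ∧
    ∀ v, ∃ r ∈ R, (SimpleGraph.fromEdgeSet (T : Set (Sym2 V))).Reachable v r

lemma det_groundedLap_eq_sum (R : Finset V) (Q : Matrix V V K) :
    (groundedLap R Q).det = ∑ f : V → V with ∀ i ∈ R, f i = i,
      (∏ i ∈ Rᶜ, Q i (f i)) * (functionalLap K R f).det := by
  let c : V → V → K := fun i k => if i ∈ R then (if k = i then 1 else 0) else Q i k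
  let w : V → V → V → K := fun i k =>
    if i ∈ R then Pi.single i 1 else Pi.single i 1 - Pi.single k 1
  have hL : groundedLap R Q = fun i => ∑ k, c i k • w i k := by
    funext i
    by_cases hi : i ∈ R <;> simp [groundedLap, c, w, hi]
  have key := (Matrix.detRowAlternating (n := V) (R := K)).toMultilinearMap.map_sum
    (fun i k => c i k • w i k)
  have hdet : (groundedLap R Q).det =
      ∑ f : V → V, (∏ i, c i (f i)) * (functionalLap K R f).det := by
    rw [hL]
    refine key.trans (Finset.sum_congr rfl fun f _ => ?_)
    exact (Matrix.detRowAlternating (n := V) (R := K)).toMultilinearMap.map_smul_univ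
      (fun i => c i (f i)) (fun i => w i (f i))
  rw [hdet, Finset.sum_filter]
  refine Finset.sum_congr rfl fun f _ => ?_
  split_ifs with hf
  · congr 1
    rw [← Finset.prod_mul_prod_compl R]
    rw [Finset.prod_eq_one (s := R) (fun i hi => by simp [c, hi, hf i hi]), one_mul]
    exact Finset.prod_congr rfl fun i hi => by simp [c, Finset.mem_compl.mp hi]
  · push Not at hf
    obtain ⟨i, hi, hne⟩ := hf
    rw [Finset.prod_eq_zero (Finset.mem_univ i) (by simp [c, hi, hne]), zero_mul]

lemma det_functionalLap_of_isRooted {R : Finset V} {f : V → V} (hf : IsRooted R f) :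
    (functionalLap K R f).det = 1 := by
  obtain ⟨h, hh⟩ := hf
  have hdiag : ∀ i j, h i = h j → functionalLap K R f i j = (1 : Matrix V V K) i j := by
    intro i j hij
    by_cases hi : i ∈ R
    · simp [functionalLap, hi, Matrix.one_apply, Pi.single_apply, eq_comm]
    · have : j ≠ f i := fun e => by have := hh i hi; rw [← e] at this; omega
      simp [functionalLap, hi, Matrix.one_apply, Pi.single_apply, this, eq_comm]
  have hM : BlockTriangular (functionalLap K R f) (fun i => OrderDual.toDual (h i)) := by
    intro i j hij
    have hij : h i < h j := hij
    have hne : j ≠ i := fun e => by simp [e] at hij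
    by_cases hi : i ∈ R
    · simp [functionalLap, hi, hne]
    · have : j ≠ f i := fun e => by have := hh i hi; rw [← e] at this; omega
      simp [functionalLap, hi, hne, this]
  rw [hM.det]
  refine Finset.prod_eq_one fun a _ => ?_
  have : (functionalLap K R f).toSquareBlock (fun i => OrderDual.toDual (h i)) a = 1 := by
    ext ⟨i, hi⟩ ⟨j, hj⟩
    rw [Matrix.toSquareBlock_def, Matrix.of_apply,
      hdiag i j (OrderDual.toDual.injective (hi.trans hj.symm))]
    simp [Matrix.one_apply]
  rw [this, Matrix.det_one]

lemma det_functionalLap_of_not_isRooted [IsDomain K] {R : Finset V} {f : V → V}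
    (hf : ¬ IsRooted R f) : (functionalLap K R f).det = 0 := by
  classical
  have hex : ∃ i, ∀ n, f^[n] i ∉ R := by
    by_contra! hall
    refine hf ⟨fun i => Nat.find (hall i), fun i hi => ?_⟩
    change Nat.find (hall (f i)) < Nat.find (hall i)
    have hspec := Nat.find_spec (hall i)
    rcases hn : Nat.find (hall i) with _ | n
    · rw [hn] at hspec
      exact absurd hspec hi
    · rw [hn, Function.iterate_succ_apply] at hspec
      exact (Nat.lt_succ_of_le (Nat.find_min' (hall (f i)) hspec))
  obtain ⟨i₀, hi₀⟩ := hex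
  refine Matrix.exists_mulVec_eq_zero_iff.mp
    ⟨fun i => if ∀ n, f^[n] i ∉ R then 1 else 0, fun h => ?_, ?_⟩
  · have := congrFun h i₀
    simp [hi₀] at this
  · funext i
    by_cases hi : i ∈ R
    · have : ¬ ∀ n, f^[n] i ∉ R := fun h => h 0 hi
      simp [Matrix.mulVec, functionalLap, hi, this]
    · have : (∀ n, f^[n] (f i) ∉ R) ↔ ∀ n, f^[n] i ∉ R := by
        refine ⟨fun h n => ?_, fun h n => h (n + 1)⟩
        rcases n with _ | n
        · exact hi
        · exact h n
      simp only [Matrix.mulVec, functionalLap, hi, if_false, sub_dotProduct, single_one_dotProduct,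
        Pi.zero_apply]
      simp only [this, sub_self]

lemma IsRooted.injOn_edge {R : Finset V} {f : V → V} (hf : IsRooted R f) :
    Set.InjOn (fun i => s(i, f i)) (Rᶜ : Finset V) := by
  obtain ⟨h, hh⟩ := hf
  intro i hi j hj hij
  have hi' := hh i (by simpa using hi)
  have hj' := hh j (by simpa using hj)
  rcases Sym2.eq_iff.mp hij with ⟨e, -⟩ | ⟨e₁, e₂⟩
  · exact e
  · rw [e₂] at hi'
    rw [← e₁] at hj'
    omega

lemma IsRooted.isRootedForest {R : Finset V} {f : V → V} (hf : IsRooted R f) :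
    IsRootedForest R (edgesOf R f) := by
  have hcard : (edgesOf R f).card + R.card = Fintype.card V := by
    rw [edgesOf, Finset.card_image_of_injOn hf.injOn_edge, Finset.card_compl_add_card]
  obtain ⟨h, hh⟩ := hf
  have hne : ∀ i ∉ R, i ≠ f i := fun i hi e => by have := hh i hi; rw [← e] at this; omega
  refine ⟨fun e he => ?_, hcard, fun v => ?_⟩
  · obtain ⟨i, hi, rfl⟩ := Finset.mem_image.mp he
    simpa using hne i (Finset.mem_compl.mp hi)
  · induction hn : h v using Nat.strong_induction_on generalizing v with
    | _ n ih =>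
      by_cases hv : v ∈ R
      · exact ⟨v, hv, .rfl⟩
      · obtain ⟨r, hr, hreach⟩ := ih (h (f v)) (hn ▸ hh v hv) (f v) rfl
        refine ⟨r, hr, SimpleGraph.Reachable.trans (SimpleGraph.Adj.reachable ?_) hreach⟩
        rw [SimpleGraph.fromEdgeSet_adj]
        exact ⟨Finset.mem_image.mpr ⟨v, Finset.mem_compl.mpr hv, rfl⟩, hne v hv⟩

lemma IsRootedForest.exists_isRooted {R : Finset V} {T : Finset (Sym2 V)}
    (hT : IsRootedForest R T) :
    ∃ f : V → V, (∀ i ∈ R, f i = i) ∧ IsRooted R f ∧ edgesOf R f = T := by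
  classical
  obtain ⟨-, hcard, hreach⟩ := hT
  have hex : ∀ v, ∃ n, ∃ r ∈ R,
      ∃ p : (SimpleGraph.fromEdgeSet (T : Set (Sym2 V))).Walk v r, p.length = n := fun v => by
    obtain ⟨r, hr, ⟨p⟩⟩ := hreach v
    exact ⟨_, r, hr, p, rfl⟩
  have hnext : ∀ v, ∃ w, (v ∈ R → w = v) ∧
      (v ∉ R → s(v, w) ∈ T ∧ Nat.find (hex w) < Nat.find (hex v)) := by
    intro v
    by_cases hv : v ∈ R
    · exact ⟨v, fun _ => rfl, fun h => absurd hv h⟩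
    · obtain ⟨r, hr, p, hp⟩ := Nat.find_spec (hex v)
      cases p with
      | nil => exact absurd hr hv
      | @cons _ w _ hadj q =>
        refine ⟨w, fun h => absurd h hv, fun _ =>
          ⟨((SimpleGraph.fromEdgeSet_adj _).mp hadj).1, ?_⟩⟩
        rw [← hp, SimpleGraph.Walk.length_cons]
        exact Nat.lt_succ_of_le (Nat.find_min' _ ⟨r, hr, q, rfl⟩)
  choose f hfR hf using hnext
  have hrooted : IsRooted R f := ⟨fun v => Nat.find (hex v), fun i hi => (hf i hi).2⟩
  refine ⟨f, hfR, hrooted, Finset.eq_of_subset_of_card_le (fun e he => ?_) ?_⟩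
  · obtain ⟨i, hi, rfl⟩ := Finset.mem_image.mp he
    exact (hf i (Finset.mem_compl.mp hi)).1
  · have := hrooted.isRootedForest.2.1
    omega

lemma edgesOf_injOn (R : Finset V) :
    Set.InjOn (edgesOf R) {f | (∀ i ∈ R, f i = i) ∧ IsRooted R f} := by
  rintro f ⟨hfR, h, hh⟩ g ⟨hgR, h', hh'⟩ hfg
  by_contra hne
  let B : Finset V := Finset.univ.filter fun i => f i ≠ g i
  have hB : B.Nonempty := by
    obtain ⟨i, hi⟩ := Function.ne_iff.mp hne
    exact ⟨i, by simpa [B] using hi⟩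
  obtain ⟨i, hiB, hmax⟩ := B.exists_max_image h hB
  have hi : f i ≠ g i := by simpa [B] using hiB
  have hiR : i ∉ R := fun hR => hi ((hfR i hR).trans (hgR i hR).symm)
  have hmem : s(i, g i) ∈ edgesOf R f :=
    hfg ▸ Finset.mem_image.mpr ⟨i, Finset.mem_compl.mpr hiR, rfl⟩
  obtain ⟨k, hk, hke⟩ := Finset.mem_image.mp hmem
  have hkR := Finset.mem_compl.mp hk
  rcases Sym2.eq_iff.mp hke with ⟨rfl, e⟩ | ⟨rfl, e⟩
  · exact hi e
  · have h1 := hh _ hkR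
    rw [e] at h1
    have hbad : g i ∈ B := by
      simp only [B, Finset.mem_filter, Finset.mem_univ, true_and, e]
      intro e'
      have h2 := hh' _ hkR
      have h3 := hh' _ hiR
      rw [← e'] at h2
      omega
    have := hmax _ hbad
    omega

/-- The principal-minors matrix-forest theorem. -/
theorem det_groundedLap [IsDomain K] (R : Finset V) (Q : Matrix V V K)
    (hQ : ∀ a b, Q a b = Q b a) :
    (groundedLap R Q).det = ∑ T : Finset (Sym2 V) with IsRootedForest R T,
      ∏ e ∈ T, Sym2.lift ⟨fun a b => Q a b, fun a b => hQ a b⟩ e := by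
  classical
  rw [det_groundedLap_eq_sum, ← Finset.sum_filter_add_sum_filter_not _ (IsRooted R)]
  rw [Finset.sum_eq_zero (s := Finset.filter (fun f => ¬ IsRooted R f) _) (fun f hf => by
    rw [det_functionalLap_of_not_isRooted (Finset.mem_filter.mp hf).2, mul_zero]), add_zero]
  refine Finset.sum_bij (fun f _ => edgesOf R f) (fun f hf => ?_) (fun f hf g hg e => ?_)
    (fun T hT => ?_) (fun f hf => ?_)
  · exact Finset.mem_filter.mpr ⟨Finset.mem_univ _, (Finset.mem_filter.mp hf).2.isRootedForest⟩
  · simp only [Finset.mem_filter, Finset.mem_univ, true_and] at hf hg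
    exact edgesOf_injOn R hf hg e
  · obtain ⟨f, h1, h2, h3⟩ := (Finset.mem_filter.mp hT).2.exists_isRooted
    exact ⟨f, by simp [h2]; exact h1, h3⟩
  · have hr := (Finset.mem_filter.mp hf).2
    rw [det_functionalLap_of_isRooted hr, mul_one, edgesOf, Finset.prod_image hr.injOn_edge]
    rfl

section Graph

open SimpleGraph

omit [Fintype V] [DecidableEq V] in
lemma natCard_edgeSet_fromEdgeSet {T : Finset (Sym2 V)} (hT : ∀ e ∈ T, ¬ e.IsDiag) :
    Nat.card (fromEdgeSet (T : Set (Sym2 V))).edgeSet = T.card := by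
  have : (fromEdgeSet (T : Set (Sym2 V))).edgeSet = (T : Set (Sym2 V)) := by
    rw [edgeSet_fromEdgeSet]
    ext e
    simpa using hT e
  rw [this]
  simp

omit [DecidableEq V] in
lemma isRootedForest_singleton_iff {T : Finset (Sym2 V)} (hT : ∀ e ∈ T, ¬ e.IsDiag) (r : V) :
    IsRootedForest {r} T ↔ (fromEdgeSet (T : Set (Sym2 V))).IsTree := by
  rw [isTree_iff_connected_and_card, natCard_edgeSet_fromEdgeSet hT, Nat.card_eq_fintype_card,
    and_comm, IsRootedForest, and_iff_right hT]
  simp only [Finset.card_singleton, Finset.mem_singleton, exists_eq_left]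
  refine and_congr_right fun _ => ⟨fun h => ?_, fun h v => h v r⟩
  have : Nonempty V := ⟨r⟩
  exact ⟨fun u v => (h u).trans (h v).symm⟩

lemma sup_edge_connected_iff (H : SimpleGraph V) {i j : V} (hij : i ≠ j) :
    (H ⊔ edge i j).Connected ↔ ∀ v, ∃ r ∈ ({i, j} : Finset V), H.Reachable v r := by
  simp only [Finset.mem_insert, Finset.mem_singleton, exists_eq_or_imp, exists_eq_left]
  have hadj : (H ⊔ edge i j).Adj i j := by simp [edge_adj, hij]
  constructor
  · intro hc v
    by_contra! hv
    obtain ⟨p⟩ := hc v i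
    obtain ⟨e, -, ha, hb⟩ := p.exists_boundary_dart {w | H.Reachable v w} .rfl hv.1
    rcases sup_adj .. |>.mp e.adj with h | h
    · exact hb (Reachable.trans ha h.reachable)
    · obtain ⟨⟨h, -⟩ | ⟨h, -⟩, -⟩ := edge_adj .. |>.mp h
      · exact hv.1 (h ▸ ha)
      · exact hv.2 (h ▸ ha)
  · intro h
    have : Nonempty V := ⟨i⟩
    have h' : ∀ v, (H ⊔ edge i j).Reachable v i := fun v => by
      rcases h v with h | h
      · exact h.mono le_sup_left
      · exact (h.mono le_sup_left).trans hadj.reachable.symm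
    exact ⟨fun u v => (h' u).trans (h' v).symm⟩

lemma isRootedForest_pair_iff {F : Finset (Sym2 V)} (hF : ∀ e ∈ F, ¬ e.IsDiag) {i j : V}
    (hij : i ≠ j) :
    IsRootedForest {i, j} F ↔ s(i, j) ∉ F ∧
      (fromEdgeSet (F : Set (Sym2 V)) ⊔ edge i j).IsTree := by
  have hsup : fromEdgeSet (F : Set (Sym2 V)) ⊔ edge i j =
      fromEdgeSet ((insert s(i, j) F : Finset (Sym2 V)) : Set (Sym2 V)) := by
    rw [edge, ← fromEdgeSet_union]
    congr 1
    ext; simp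
  have hins : ∀ e ∈ insert s(i, j) F, ¬ e.IsDiag := by
    intro e he
    rcases Finset.mem_insert.mp he with rfl | he
    · simpa using hij
    · exact hF e he
  have hcard : ∀ H : SimpleGraph V, H = fromEdgeSet (F : Set (Sym2 V)) ⊔ edge i j →
      Nat.card H.edgeSet = (insert s(i, j) F).card := by
    rintro H rfl
    rw [hsup, natCard_edgeSet_fromEdgeSet hins]
  rw [isTree_iff_connected_and_card, hcard _ rfl, IsRootedForest, and_iff_right hF,
    ← sup_edge_connected_iff _ hij, Nat.card_eq_fintype_card, Finset.card_pair hij]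
  constructor
  · rintro ⟨h1, h2⟩
    have hle := h2.card_vert_le_card_edgeSet_add_one
    rw [hcard _ rfl, Nat.card_eq_fintype_card] at hle
    have hnot : s(i, j) ∉ F := fun hmem => by
      rw [Finset.insert_eq_of_mem hmem] at hle
      omega
    exact ⟨hnot, h2, by rw [Finset.card_insert_of_notMem hnot]; omega⟩
  · rintro ⟨hnot, h2, h3⟩
    rw [Finset.card_insert_of_notMem hnot] at h3
    exact ⟨by omega, h2⟩

end Graph

lemma isSpanningTreeOf_iff {d : ℕ} (G : SimpleGraph (Fin d)) (T : Finset (Sym2 (Fin d)))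
    (r : Fin d) : IsSpanningTreeOf G T ↔ ↑T ⊆ G.edgeSet ∧ IsRootedForest {r} T := by
  refine and_congr_right fun hT => ?_
  rw [isRootedForest_singleton_iff (fun e he => G.not_isDiag_of_mem_edgeSet (hT he)),
    SimpleGraph.isTree_iff]

lemma isTwoForestOf_iff {d : ℕ} (G : SimpleGraph (Fin d)) (F : Finset (Sym2 (Fin d)))
    {i j : Fin d} (hij : i ≠ j) :
    IsTwoForestOf G F i j ↔ ↑F ⊆ G.edgeSet ∧ IsRootedForest {i, j} F := by
  refine and_congr_right fun hF => ?_
  have hd : ∀ e ∈ F, ¬ e.IsDiag := fun e he => G.not_isDiag_of_mem_edgeSet (hF he)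
  constructor
  · rintro ⟨hac, ⟨c₁, c₂, -, hc⟩, hij'⟩
    rw [isRootedForest_pair_iff hd hij, SimpleGraph.isTree_iff, sup_edge_connected_iff _ hij]
    refine ⟨fun hmem => hij' (SimpleGraph.Adj.reachable ?_), fun v => ?_,
      hac.sup_edge_of_not_reachable hij'⟩
    · rw [SimpleGraph.fromEdgeSet_adj]
      exact ⟨hmem, hij⟩
    · simp only [Finset.mem_insert, Finset.mem_singleton, exists_eq_or_imp, exists_eq_left,
        ← SimpleGraph.ConnectedComponent.eq] at hij' ⊢
      have h₁ := hc (SimpleGraph.connectedComponentMk _ v)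
      have h₂ := hc (SimpleGraph.connectedComponentMk _ i)
      have h₃ := hc (SimpleGraph.connectedComponentMk _ j)
      grind
  · intro h
    have hreach := h.2.2
    obtain ⟨hnot, htree⟩ := (isRootedForest_pair_iff hd hij).mp h
    have hij' : ¬ (SimpleGraph.fromEdgeSet (F : Set (Sym2 (Fin d)))).Reachable i j := fun hr => by
      rcases (SimpleGraph.isAcyclic_sup_fromEdgeSet_iff.mp htree.isAcyclic).2 hr with h | h
      · exact hij h
      · exact hnot ((SimpleGraph.fromEdgeSet_adj _).mp h).1
    refine ⟨htree.isAcyclic.anti le_sup_left,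
      ⟨SimpleGraph.connectedComponentMk _ i, SimpleGraph.connectedComponentMk _ j,
        fun h => hij' (SimpleGraph.ConnectedComponent.exact h), fun c => ?_⟩, hij'⟩
    induction c using SimpleGraph.ConnectedComponent.ind with
    | _ v => simpa using hreach v

omit [DecidableEq V] in
lemma sum_filter_subgraph {G : SimpleGraph V} {Q : Matrix V V K} (hQ : ∀ a b, Q a b = Q b a)
    (hQG : ∀ u v, ¬ G.Adj u v → Q u v = 0) {p q : Finset (Sym2 V) → Prop}
    [DecidablePred p] [DecidablePred q] (hpq : ∀ T, p T ↔ ↑T ⊆ G.edgeSet ∧ q T) :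
    ∑ T : Finset (Sym2 V) with p T, ∏ e ∈ T,
        Sym2.lift ⟨fun a b => Q a b, fun a b => hQ a b⟩ e =
      ∑ T : Finset (Sym2 V) with q T, ∏ e ∈ T,
        Sym2.lift ⟨fun a b => Q a b, fun a b => hQ a b⟩ e := by
  refine Finset.sum_subset (fun T hT => ?_) fun T hT hT' => ?_
  · simp only [Finset.mem_filter, Finset.mem_univ, true_and] at hT ⊢
    exact ((hpq T).mp hT).2
  · simp only [Finset.mem_filter, Finset.mem_univ, true_and] at hT hT'
    have : ¬ ↑T ⊆ G.edgeSet := fun h => hT' ((hpq T).mpr ⟨h, hT⟩)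
    obtain ⟨e, he, heG⟩ := Set.not_subset.mp this
    refine Finset.prod_eq_zero he ?_
    induction e using Sym2.ind with
    | _ a b => exact hQG a b heG

lemma groundedLap_mulVec_of_mem {R : Finset V} {i : V} (hi : i ∈ R) (Q : Matrix V V K) (x : V → K) :
    (groundedLap R Q *ᵥ x) i = x i := by
  simp [Matrix.mulVec, groundedLap, hi]

lemma groundedLap_mulVec_of_notMem {R : Finset V} {i : V} (hi : i ∉ R) (Q : Matrix V V K)
    (x : V → K) : (groundedLap R Q *ᵥ x) i = ∑ k, Q i k * (x i - x k) := by
  simp only [Matrix.mulVec, groundedLap, hi, if_false, sum_dotProduct, smul_dotProduct,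
    sub_dotProduct, single_one_dotProduct, smul_eq_mul]

lemma adjugate_groundedLap_diag (R : Finset V) (Q : Matrix V V K) (i : V) :
    (groundedLap R Q).adjugate i i = (groundedLap (insert i R) Q).det := by
  rw [Matrix.adjugate_apply]
  congr 1
  ext k l
  by_cases hk : k = i
  · subst hk
    simp [groundedLap]
  · simp [groundedLap, hk]

lemma signedLap_mulVec_apply {d : ℕ} {Q : Matrix (Fin d) (Fin d) ℝ} (hQ : ∀ i, Q i i = 0)
    (x : Fin d → ℝ) (i : Fin d) : (signedLap Q *ᵥ x) i = ∑ k, Q i k * (x i - x k) := by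
  rw [signedLap, Matrix.sub_mulVec, Pi.sub_apply, Matrix.mulVec_diagonal,
    Finset.sum_erase _ (hQ i)]
  simp only [mul_sub, Finset.sum_sub_distrib, ← Finset.sum_mul]
  rfl

lemma projP_mulVec_apply {d : ℕ} (x : Fin d → ℝ) (i : Fin d) :
    (projP d *ᵥ x) i = x i - (d : ℝ)⁻¹ * ∑ k, x k := by
  rw [projP, Matrix.sub_mulVec, Matrix.smul_mulVec, Matrix.vecMulVec_mulVec]
  simp [dotProduct]

omit [DecidableEq V] in
lemma sum_laplacian_eq_zero {Q : Matrix V V ℝ} (hQ : ∀ a b, Q a b = Q b a) (x : V → ℝ) :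
    ∑ i, ∑ k, Q i k * (x i - x k) = 0 := by
  have h : ∑ i, ∑ k, Q i k * (x i - x k) = -∑ i, ∑ k, Q i k * (x i - x k) := by
    conv_lhs => rw [Finset.sum_comm]
    simp only [← Finset.sum_neg_distrib]
    exact Finset.sum_congr rfl fun i _ => Finset.sum_congr rfl fun k _ => by rw [hQ k i]; ring
  linarith

lemma signedLap_isSymm {d : ℕ} {Q : Matrix (Fin d) (Fin d) ℝ} (hQ : ∀ a b, Q a b = Q b a) :
    (signedLap Q).IsSymm :=
  (Matrix.isSymm_diagonal _).sub (Matrix.IsSymm.ext fun i j => hQ j i)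

lemma projP_isSymm (d : ℕ) : (projP d).IsSymm :=
  Matrix.isSymm_one.sub (Matrix.IsSymm.smul (Matrix.IsSymm.ext fun i j => by simp [vecMulVec]) _)

lemma det_groundedLap_singleton_ne_zero {d : ℕ} {Q S : Matrix (Fin d) (Fin d) ℝ}
    (hQsym : ∀ a b, Q a b = Q b a) (hQdiag : ∀ i, Q i i = 0) (hSsym : S.IsSymm)
    (hΘS : signedLap Q * S = projP d) (j : Fin d) : (groundedLap {j} Q).det ≠ 0 := by
  intro hdet
  obtain ⟨v, hv, hMv⟩ := Matrix.exists_mulVec_eq_zero_iff.mpr hdet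
  have hvj : v j = 0 := by
    rw [← groundedLap_mulVec_of_mem (Finset.mem_singleton_self j) Q v, hMv, Pi.zero_apply]
  have hoff : ∀ k ≠ j, ∑ l, Q k l * (v k - v l) = 0 := fun k hk => by
    rw [← groundedLap_mulVec_of_notMem (R := {j}) (by simpa using hk), hMv, Pi.zero_apply]
  have hΘv : signedLap Q *ᵥ v = 0 := by
    funext k
    rw [signedLap_mulVec_apply hQdiag, Pi.zero_apply]
    by_cases hk : k = j
    · rw [← sum_laplacian_eq_zero hQsym v, hk]
      exact (Finset.sum_eq_single j (fun l _ hl => hoff l hl) (by simp)).symm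
    · exact hoff k hk
  have hSΘ : S * signedLap Q = projP d := by
    rw [← (projP_isSymm d).eq, ← hΘS, Matrix.transpose_mul, hSsym.eq, (signedLap_isSymm hQsym).eq]
  have hPv : projP d *ᵥ v = 0 := by
    rw [← hSΘ, ← Matrix.mulVec_mulVec, hΘv, Matrix.mulVec_zero]
  refine hv (funext fun k => ?_)
  have hk := congrFun hPv k
  have hj := congrFun hPv j
  rw [projP_mulVec_apply, Pi.zero_apply] at hk hj
  rw [Pi.zero_apply]
  linarith

lemma det_mul_variogram {d : ℕ} {Q S : Matrix (Fin d) (Fin d) ℝ}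
    (hQdiag : ∀ i, Q i i = 0) (hSsym : S.IsSymm)
    (hΘS : signedLap Q * S = projP d) {i j : Fin d} (hij : i ≠ j) :
    (groundedLap {j} Q).det * (S i i + S j j - 2 * S i j) = (groundedLap {i, j} Q).det := by
  let x : Fin d → ℝ := S *ᵥ (Pi.single i 1 - Pi.single j 1)
  have hx : ∀ k, x k = S k i - S k j := fun k => by
    simp [x, Matrix.mulVec_sub]
  have hΘx : signedLap Q *ᵥ x = Pi.single i 1 - Pi.single j 1 := by
    rw [Matrix.mulVec_mulVec, hΘS]
    funext k
    simp [projP_mulVec_apply]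
  have hMy : groundedLap {j} Q *ᵥ (fun k => x k - x j) = Pi.single i 1 := by
    funext k
    by_cases hk : k = j
    · subst hk
      rw [groundedLap_mulVec_of_mem (Finset.mem_singleton_self k)]
      simp [hij.symm]
    · rw [groundedLap_mulVec_of_notMem (by simpa using hk)]
      simp only [sub_sub_sub_cancel_right]
      rw [← signedLap_mulVec_apply hQdiag, hΘx]
      simp [hk]
  have key : (groundedLap {j} Q).adjugate *ᵥ (groundedLap {j} Q *ᵥ fun k => x k - x j) =
      (groundedLap {j} Q).det • fun k => x k - x j := by
    rw [Matrix.mulVec_mulVec, Matrix.adjugate_mul, Matrix.smul_mulVec, Matrix.one_mulVec]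
  have key_i := congrFun key i
  rw [hMy, Matrix.mulVec_single_one, Matrix.col_apply, adjugate_groundedLap_diag] at key_i
  rw [key_i, Pi.smul_apply, smul_eq_mul, hx, hx, hSsym.apply i j]
  ring

end MatrixForest

/-- all-minors matrix-tree formula for the variogram of the Moore–Penrose
pseudoinverse of a signed Laplacian of a connected graph: the spanning-tree polynomial
is nonzero and `Γ_{ij}` is the ratio of the two-component spanning forest polynomial
(separating `i` and `j`) by the spanning-tree polynomial. -/
theorem statement5 {d : ℕ} (hd : 2 ≤ d)
    (G : SimpleGraph (Fin d)) (hG : G.Connected)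
    (Q S Γ : Matrix (Fin d) (Fin d) ℝ)
    (hQsym : ∀ a b, Q a b = Q b a) (hQdiag : ∀ i, Q i i = 0)
    (hQG : ∀ u v, ¬ G.Adj u v → Q u v = 0)
    (hrank : (signedLap Q).rank = d - 1)
    (hSsym : S.IsSymm) (hS1 : S *ᵥ (1 : Fin d → ℝ) = 0)
    (hΘS : signedLap Q * S = projP d)
    (hΓ : ∀ i j, Γ i j = S i i + S j j - 2 * S i j) :
    (∑ T ∈ Finset.univ.filter (fun T : Finset (Sym2 (Fin d)) => IsSpanningTreeOf G T),
        ∏ e ∈ T, Sym2.lift ⟨fun a b => Q a b, fun a b => hQsym a b⟩ e) ≠ 0 ∧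
    ∀ i j : Fin d, i ≠ j →
      Γ i j =
        (∑ F ∈ Finset.univ.filter (fun F : Finset (Sym2 (Fin d)) => IsTwoForestOf G F i j),
            ∏ e ∈ F, Sym2.lift ⟨fun a b => Q a b, fun a b => hQsym a b⟩ e) /
        (∑ T ∈ Finset.univ.filter (fun T : Finset (Sym2 (Fin d)) => IsSpanningTreeOf G T),
            ∏ e ∈ T, Sym2.lift ⟨fun a b => Q a b, fun a b => hQsym a b⟩ e) := by
  have hT : ∀ r, (MatrixForest.groundedLap {r} Q).det = _ := fun r =>
    (MatrixForest.det_groundedLap {r} Q hQsym).trans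
      (MatrixForest.sum_filter_subgraph hQsym hQG
        fun T => MatrixForest.isSpanningTreeOf_iff G T r).symm
  have hne := fun r => MatrixForest.det_groundedLap_singleton_ne_zero hQsym hQdiag hSsym hΘS r
  refine ⟨hT ⟨0, by omega⟩ ▸ hne _, fun i j hij => ?_⟩
  have hF := (MatrixForest.det_groundedLap {i, j} Q hQsym).trans
    (MatrixForest.sum_filter_subgraph hQsym hQG
      fun F => MatrixForest.isTwoForestOf_iff G F hij).symm
  rw [← hF, ← hT j, eq_div_iff (hne j), hΓ, mul_comm]
  exact MatrixForest.det_mul_variogram hQdiag hSsym hΘS hij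
end
end

section
/- Let T = (V, E) be a tree (a connected acyclic finite simple graph) on V = {1,…,d} with d ≥ 2, let Q be a d×d real symmetric matrix with zero diagonal such that Q_{uv} = 0 whenever uv ∉ E, and let Θ = D − Q be the associated signed Laplacian. Assume Θ is positive semidefinite of rank d−1, let Σ be its Moore–Penrose pseudoinverse and Γ the variogram of Σ. Then for every edge ij ∈ E one has Q_{ij} ≠ 0 and Γ_{ij} = 1/Q_{ij}. -/
open Matrix

noncomputable section

/-- The signed Laplacian of `Q` acts on a vector `x` by `(Θ x)_u = ∑_v Q_{uv} (x_u - x_v)`. -/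
theorem signedLap_mulVec {d : ℕ} (Q : Matrix (Fin d) (Fin d) ℝ) (hQdiag : ∀ i, Q i i = 0)
    (x : Fin d → ℝ) (u : Fin d) :
    (signedLap Q *ᵥ x) u = ∑ v, Q u v * (x u - x v) := by
  have h : ∑ v ∈ Finset.univ.erase u, Q u v = ∑ v, Q u v :=
    Finset.sum_erase _ (hQdiag u)
  simp only [signedLap, sub_mulVec, Pi.sub_apply, mulVec_diagonal, h, mul_sub,
    Finset.sum_sub_distrib, Finset.sum_mul]
  rfl

theorem projP_mulVec_sub {d : ℕ} (x : Fin d → ℝ) (i j : Fin d) :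
    (projP d *ᵥ x) i - (projP d *ᵥ x) j = x i - x j := by
  simp [projP, sub_mulVec, smul_mulVec, vecMulVec_mulVec, -vecMulVec_one, -one_vecMulVec]

/-- If every edge other than the bridge `ij` preserves `x`, while `x i = 1` and `x j = 0`, then the
signed Laplacian sends `x` to `Q_{ij} (e_i - e_j)`. -/
theorem signedLap_mulVec_of_cut {d : ℕ} (Q : Matrix (Fin d) (Fin d) ℝ)
    (hQsym : ∀ a b, Q a b = Q b a) (hQdiag : ∀ i, Q i i = 0) (x : Fin d → ℝ) {i j : Fin d}
    (hi : x i = 1) (hj : x j = 0)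
    (hx : ∀ u v, s(u, v) ≠ s(i, j) → Q u v ≠ 0 → x u = x v) :
    signedLap Q *ᵥ x = Q i j • (Pi.single i 1 - Pi.single j 1) := by
  have hij : i ≠ j := by
    rintro rfl
    simp [hi] at hj
  have key : ∀ u v, s(u, v) ≠ s(i, j) → Q u v * (x u - x v) = 0 := fun u v huv => by
    by_cases h : Q u v = 0
    · simp [h]
    · simp [hx u v huv h]
  ext u
  rw [signedLap_mulVec Q hQdiag]
  by_cases hui : u = i
  · subst hui
    rw [Finset.sum_eq_single j (fun v _ hv => key u v (by simp [hv, hij])) (by simp)]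
    simp [hi, hj, hij]
  by_cases huj : u = j
  · subst huj
    rw [Finset.sum_eq_single i (fun v _ hv => key u v (by simp [hv, hui])) (by simp)]
    simp [hi, hj, hui, hQsym u i]
  · rw [Finset.sum_eq_zero (fun v _ => key u v (by simp [hui, huj]))]
    simp [hui, huj]

/-- A bridge `ij` admits a function equal to `1` at `i` and `0` at `j` that is preserved by every
other edge. -/
theorem exists_cut_of_isBridge {V : Type*} {G : SimpleGraph V} {i j : V}
    (h : G.IsBridge s(i, j)) :
    ∃ x : V → ℝ, x i = 1 ∧ x j = 0 ∧ ∀ u v, s(u, v) ≠ s(i, j) → G.Adj u v → x u = x v := by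
  classical
  rw [SimpleGraph.isBridge_iff] at h
  refine ⟨fun u => if (G.deleteEdges {s(i, j)}).Reachable i u then 1 else 0, if_pos .rfl,
    if_neg h, fun u v huv hadj => ?_⟩
  have huv' : (G.deleteEdges {s(i, j)}).Adj u v := by
    simpa only [SimpleGraph.deleteEdges_adj, Set.mem_singleton_iff] using ⟨hadj, huv⟩
  have : (G.deleteEdges {s(i, j)}).Reachable i u ↔ (G.deleteEdges {s(i, j)}).Reachable i v :=
    ⟨fun h => h.trans huv'.reachable, fun h => h.trans huv'.symm.reachable⟩
  simp only [this]

/-- for a tree `T = (V, E)` and a weight matrix `Q` supported on `E` whose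
signed Laplacian `Θ = D - Q` is positive semidefinite of rank `d - 1`, with `Σ` the
Moore–Penrose pseudoinverse of `Θ` (symmetric, `Σ𝟙 = 0`, `ΘΣ = P`) and `Γ` the
variogram of `Σ`, every edge `ij ∈ E` satisfies `Q_{ij} ≠ 0` and `Γ_{ij} = 1 / Q_{ij}`. -/
theorem statement6 {d : ℕ} (hd : 2 ≤ d)
    (G : SimpleGraph (Fin d)) (hG : G.IsTree)
    (Q S Γ : Matrix (Fin d) (Fin d) ℝ)
    (hQsym : ∀ a b, Q a b = Q b a) (hQdiag : ∀ i, Q i i = 0)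
    (hQG : ∀ u v, ¬ G.Adj u v → Q u v = 0)
    (hpsd : (signedLap Q).PosSemidef)
    (hrank : (signedLap Q).rank = d - 1)
    (hSsym : S.IsSymm) (hS1 : S *ᵥ (1 : Fin d → ℝ) = 0)
    (hΘS : signedLap Q * S = projP d)
    (hΓ : ∀ i j, Γ i j = S i i + S j j - 2 * S i j) :
    ∀ i j : Fin d, G.Adj i j → Q i j ≠ 0 ∧ Γ i j = 1 / Q i j := by
  intro i j hij
  obtain ⟨x, hi, hj, hx⟩ := exists_cut_of_isBridge
    (SimpleGraph.isAcyclic_iff_forall_adj_isBridge.mp hG.isAcyclic hij)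
  have hΘx := signedLap_mulVec_of_cut Q hQsym hQdiag x hi hj fun u v huv hQ =>
    hx u v huv (not_not.mp (mt (hQG u v) hQ))
  have hSΘ : S * signedLap Q = projP d := by
    have hΘsymm : (signedLap Q)ᵀ = signedLap Q := by
      simpa only [conjTranspose_eq_transpose_of_trivial] using hpsd.isHermitian.eq
    have hPsymm : (projP d)ᵀ = projP d := by
      simp [projP, transpose_vecMulVec, -vecMulVec_one, -one_vecMulVec]
    rw [← hPsymm, ← hΘS, transpose_mul, hΘsymm, hSsym.eq]
  have hPx : projP d *ᵥ x = Q i j • (S *ᵥ Pi.single i 1 - S *ᵥ Pi.single j 1) := by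
    rw [← hSΘ, ← mulVec_mulVec, hΘx, mulVec_smul, mulVec_sub]
  have hmul : Q i j * Γ i j = 1 := by
    have h := projP_mulVec_sub x i j
    simp only [hPx, hi, hj, Pi.smul_apply, Pi.sub_apply, mulVec_single_one, col_apply,
      smul_eq_mul, hSsym.apply i j] at h
    rw [hΓ]
    linarith
  exact ⟨left_ne_zero_of_mul_eq_one hmul, eq_one_div_of_mul_eq_one_right hmul⟩
end
end

section
/- Let T = (V, E) be a tree on V = {1,…,d} with d ≥ 2, let Q be a d×d real symmetric matrix with zero diagonal such that Q_{uv} = 0 whenever uv ∉ E, let Θ = D − Q be the associated signed Laplacian, assume Θ is positive semidefinite of rank d−1, let Σ be its Moore–Penrose pseudoinverse and Γ the variogram of Σ. Then for any two edges ij, st ∈ E: Q_{ij} = Q_{st} if and only if Γ_{ij} = Γ_{st}. (Hence for Hüsler–Reiss models Markov to a tree, the RCON constraints, which impose equalities among the entries of Q along edge color classes, and the RVAR constraints, which impose equalities among the entries of Γ along edge color classes, define the same model.) -/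
open Matrix

noncomputable section

/-- The action of a signed Laplacian as a weighted sum of differences. -/
theorem vecMul_signedLap {d : ℕ} {Q : Matrix (Fin d) (Fin d) ℝ}
    (hQsym : ∀ a b, Q a b = Q b a) (hQdiag : ∀ i, Q i i = 0) (f : Fin d → ℝ) (k : Fin d) :
    (f ᵥ* signedLap Q) k = ∑ a, Q k a * (f k - f a) := by
  have herase : ∑ a ∈ Finset.univ.erase k, Q k a = ∑ a, Q k a :=
    Finset.sum_erase _ (hQdiag k)
  rw [signedLap, vecMul_sub, Pi.sub_apply, vecMul_diagonal, herase]
  simp only [vecMul, dotProduct, mul_sub, Finset.sum_sub_distrib, ← Finset.sum_mul]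
  rw [mul_comm (f k)]
  congr 1
  exact Finset.sum_congr rfl fun a _ => by rw [hQsym a k, mul_comm]

/-- Deleting an edge of an acyclic graph leaves a cut, crossed by that edge only. -/
theorem SimpleGraph.IsAcyclic.exists_cut {V : Type*} {G : SimpleGraph V} (hG : G.IsAcyclic)
    {i j : V} (hij : G.Adj i j) :
    ∃ A : Set V, i ∈ A ∧ j ∉ A ∧ ∀ k ∈ A, ∀ a ∉ A, G.Adj k a → k = i ∧ a = j := by
  have hbridge : ¬ (G.deleteEdges {s(i, j)}).Reachable i j :=
    SimpleGraph.isBridge_iff.1 (SimpleGraph.isAcyclic_iff_forall_adj_isBridge.1 hG hij)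
  refine ⟨{k | (G.deleteEdges {s(i, j)}).Reachable i k}, SimpleGraph.Reachable.refl _,
    hbridge, fun k hk a ha hka => ?_⟩
  by_cases he : s(k, a) = s(i, j)
  · rcases Sym2.eq_iff.1 he with h | ⟨rfl, rfl⟩
    · exact h
    · exact absurd hk hbridge
  · refine absurd (SimpleGraph.Reachable.trans hk (SimpleGraph.Adj.reachable ?_)) ha
    simpa [SimpleGraph.deleteEdges_adj, hka] using he

/-- On the edges of a tree, weights and variogram entries are reciprocal. -/
theorem weight_mul_variogram_eq_one {d : ℕ} {G : SimpleGraph (Fin d)} (hG : G.IsAcyclic)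
    {Q S : Matrix (Fin d) (Fin d) ℝ}
    (hQsym : ∀ a b, Q a b = Q b a) (hQdiag : ∀ i, Q i i = 0)
    (hQG : ∀ u v, ¬ G.Adj u v → Q u v = 0)
    (hSsym : S.IsSymm) (hΘS : signedLap Q * S = projP d)
    {i j : Fin d} (hij : G.Adj i j) :
    Q i j * (S i i + S j j - 2 * S i j) = 1 := by
  classical
  obtain ⟨A, hi, hj, hcut⟩ := hG.exists_cut hij
  let f : Fin d → ℝ := A.indicator 1
  have hfi : f i = 1 := by simp [f, hi]
  have hfj : f j = 0 := by simp [f, hj]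
  have hterm (k a : Fin d) : Q k a * (f k - f a) =
      Q i j * ((if k = i then 1 else 0) * (if a = j then 1 else 0) -
        (if k = j then 1 else 0) * (if a = i then 1 else 0)) := by
    have hne : i ≠ j := hij.ne
    by_cases hadj : G.Adj k a
    · by_cases hk : k ∈ A <;> by_cases ha : a ∈ A
      · have h1 : k ≠ j := fun h => hj (h ▸ hk)
        have h2 : a ≠ j := fun h => hj (h ▸ ha)
        simp [f, hk, ha, h1, h2]
      · obtain ⟨rfl, rfl⟩ := hcut k hk a ha hadj
        simp [f, hk, ha, hne]
      · obtain ⟨rfl, rfl⟩ := hcut a ha k hk hadj.symm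
        simp [f, hk, ha, hne.symm, hQsym k a]
      · have h1 : k ≠ i := fun h => hk (h ▸ hi)
        have h2 : a ≠ i := fun h => ha (h ▸ hi)
        simp [f, hk, ha, h1, h2]
    · have h1 : ¬ (k = i ∧ a = j) := by rintro ⟨rfl, rfl⟩; exact hadj hij
      have h2 : ¬ (k = j ∧ a = i) := by rintro ⟨rfl, rfl⟩; exact hadj hij.symm
      rw [hQG k a hadj]
      split_ifs <;> simp_all
  have hΘ : f ᵥ* signedLap Q = Q i j • (Pi.single i 1 - Pi.single j 1) := by
    ext k
    rw [vecMul_signedLap hQsym hQdiag]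
    simp [hterm, ← Finset.mul_sum, Finset.sum_sub_distrib, Pi.single_apply]
  have hl (l : Fin d) : Q i j * (S i l - S j l) = f l - (d : ℝ)⁻¹ * ∑ k, f k := by
    have h := congrFun (congrArg (f ᵥ* ·) hΘS) l
    simpa [-vecMulVec_one, -one_vecMulVec, ← vecMul_vecMul, hΘ, smul_vecMul, sub_vecMul, projP, vecMul_sub, vecMul_smul,
      vecMul_vecMulVec, dotProduct] using h
  linear_combination hl i - hl j + hfi - hfj + Q i j * hSsym.apply i j

/-- for a tree `T = (V, E)` and a weight matrix `Q` supported on `E` whose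
signed Laplacian `Θ = D - Q` is positive semidefinite of rank `d - 1`, with `Σ` the
Moore–Penrose pseudoinverse of `Θ` (symmetric, `Σ𝟙 = 0`, `ΘΣ = P`) and `Γ` the
variogram of `Σ`, for any two edges `ij, st ∈ E` one has `Q_{ij} = Q_{st}` if and only
if `Γ_{ij} = Γ_{st}` (so on trees the RCON and RVAR equality constraints coincide). -/
theorem statement7 {d : ℕ} (hd : 2 ≤ d)
    (G : SimpleGraph (Fin d)) (hG : G.IsTree)
    (Q S Γ : Matrix (Fin d) (Fin d) ℝ)
    (hQsym : ∀ a b, Q a b = Q b a) (hQdiag : ∀ i, Q i i = 0)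
    (hQG : ∀ u v, ¬ G.Adj u v → Q u v = 0)
    (hpsd : (signedLap Q).PosSemidef)
    (hrank : (signedLap Q).rank = d - 1)
    (hSsym : S.IsSymm) (hS1 : S *ᵥ (1 : Fin d → ℝ) = 0)
    (hΘS : signedLap Q * S = projP d)
    (hΓ : ∀ i j, Γ i j = S i i + S j j - 2 * S i j) :
    ∀ i j s t : Fin d, G.Adj i j → G.Adj s t →
      (Q i j = Q s t ↔ Γ i j = Γ s t) := by
  intro i j s t hij hst
  have h₁ := weight_mul_variogram_eq_one hG.isAcyclic hQsym hQdiag hQG hSsym hΘS hij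
  have h₂ := weight_mul_variogram_eq_one hG.isAcyclic hQsym hQdiag hQG hSsym hΘS hst
  rw [← hΓ] at h₁ h₂
  rw [eq_inv_of_mul_eq_one_left h₁, eq_inv_of_mul_eq_one_left h₂, _root_.inv_inj]
end
end

section
/- Let d ≥ 2, let E be a set of unordered pairs of distinct elements of {1,…,d}, and let λ : E → {1,…,r} be an edge coloring. For ω ∈ ℝ^r let Q(ω) be the symmetric d×d matrix with Q(ω)_{uv} = ω_{λ(uv)} for uv ∈ E and Q(ω)_{uv} = 0 otherwise, and let Θ(ω) = D(Q(ω)) − Q(ω) be the associated signed Laplacian. Fix ω₀ such that Θ(ω₀) has rank d−1, let Σ(ω) be the Moore–Penrose pseudoinverse of Θ(ω) and Γ(ω) its variogram (defined for ω in a neighborhood of ω₀). Then for every i, j ∈ {1,…,r}, the partial derivative at ω₀ of the function ω ↦ Σ_{uv∈E : λ(uv)=i} Γ(ω)_{uv} with respect to ω_j exists and equals −(1/4) Σ_{uv∈E : λ(uv)=i} Σ_{st∈E : λ(st)=j} (Γ_{sv} − Γ_{us} − Γ_{tv} + Γ_{ut})², where Γ = Γ(ω₀). Consequently, the information matrix of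 the colored signed Laplacian-constrained Gaussian graphical model satisfies I(ω)_{ij} = (1/8) Σ_{uv∈E : λ(uv)=i} Σ_{st∈E : λ(st)=j} (Γ_{sv} − Γ_{us} − Γ_{tv} + Γ_{ut})². -/
open Matrix

noncomputable section

/-- The colored weight matrix `Q(ω)`: `Q(ω)_{uv} = ω_{λ(uv)}` for `uv ∈ E` (edges being
recorded as ordered pairs `(u, v)` with `u < v`) and `0` otherwise. -/
def coloredQ {d r : ℕ} (E : Finset (Fin d × Fin d)) (lam : Fin d × Fin d → Fin r)
    (ω : Fin r → ℝ) : Matrix (Fin d) (Fin d) ℝ :=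
  Matrix.of fun u v =>
    if (u, v) ∈ E then ω (lam (u, v)) else if (v, u) ∈ E then ω (lam (v, u)) else 0

/-- The Moore–Penrose pseudoinverse of a signed Laplacian `Θ` of rank `d - 1`,
computed by the formula `Σ = (Θ + (1/d)𝟙𝟙ᵀ)⁻¹ - (1/d)𝟙𝟙ᵀ` (which agrees with the
Moore–Penrose pseudoinverse whenever `Θ` is symmetric of rank `d - 1` with `Θ𝟙 = 0`). -/
def lapPinv {d : ℕ} (Θ : Matrix (Fin d) (Fin d) ℝ) : Matrix (Fin d) (Fin d) ℝ :=
  (Θ + ((d : ℝ)⁻¹) • Matrix.vecMulVec 1 1)⁻¹ - ((d : ℝ)⁻¹) • Matrix.vecMulVec 1 1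

/-- The variogram of a matrix `Σ`: `Γ_{ij} = Σ_{ii} + Σ_{jj} - 2Σ_{ij}`. -/
def vario {d : ℕ} (S : Matrix (Fin d) (Fin d) ℝ) : Matrix (Fin d) (Fin d) ℝ :=
  Matrix.of fun i j => S i i + S j j - 2 * S i j

/-- The variogram `Γ(ω)` of the pseudoinverse of the colored signed Laplacian `Θ(ω)`. -/
def coloredGamma {d r : ℕ} (E : Finset (Fin d × Fin d)) (lam : Fin d × Fin d → Fin r)
    (ω : Fin r → ℝ) : Matrix (Fin d) (Fin d) ℝ :=
  vario (lapPinv (signedLap (coloredQ E lam ω)))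

/-- The summand `(Γ_{sv} - Γ_{us} - Γ_{tv} + Γ_{ut})²` for edges `e = uv`, `f = st`. -/
def infoTerm {d : ℕ} (G : Matrix (Fin d) (Fin d) ℝ) (e f : Fin d × Fin d) : ℝ :=
  (G f.1 e.2 - G e.1 f.1 - G f.2 e.2 + G e.1 f.2) ^ 2

open scoped Matrix.Norms.Operator in
/-- Each entry of the inverse of `A + ε B` has derivative `-(A⁻¹ B A⁻¹)` at `ε = 0`. -/
theorem hasDerivAt_inv_add_smul_apply {n : Type*} [Fintype n] [DecidableEq n]
    {A : Matrix n n ℝ} (hA : IsUnit A) (B : Matrix n n ℝ) (a b : n) :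
    HasDerivAt (fun ε : ℝ => (A + ε • B)⁻¹ a b) (-(A⁻¹ * B * A⁻¹) a b) 0 := by
  obtain ⟨U, rfl⟩ := hA
  have hline : HasDerivAt (fun ε : ℝ => (U : Matrix n n ℝ) + ε • B) B 0 := by
    have h := ((hasDerivAt_id (0 : ℝ)).smul_const B).const_add (U : Matrix n n ℝ)
    rwa [one_smul] at h
  have hinv := hasFDerivAt_ringInverse (𝕜 := ℝ) U
  rw [show (U : Matrix n n ℝ) = U + (0 : ℝ) • B by simp] at hinv
  have h := (LinearMap.toContinuousLinearMap
    (Matrix.entryLinearMap ℝ ℝ a b)).hasFDerivAt.comp_hasDerivAt (0 : ℝ)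
      (hinv.comp_hasDerivAt (0 : ℝ) hline)
  simp only [Matrix.nonsing_inv_eq_ringInverse]
  refine h.congr_deriv ?_
  simp
  rfl

theorem signedLap_mulVec_apply {d : ℕ} {Q : Matrix (Fin d) (Fin d) ℝ} (hdiag : Q.diag = 0)
    (x : Fin d → ℝ) (a : Fin d) : (signedLap Q *ᵥ x) a = ∑ b, Q a b * (x a - x b) := by
  have ha : Q a a = 0 := congrFun hdiag a
  rw [signedLap, Matrix.sub_mulVec, Pi.sub_apply, Matrix.mulVec_diagonal]
  simp [Matrix.mulVec, dotProduct, mul_sub, Finset.sum_sub_distrib, ← Finset.sum_mul, ha]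

theorem signedLap_add_smul {d : ℕ} (Q R : Matrix (Fin d) (Fin d) ℝ) (ε : ℝ) :
    signedLap (Q + ε • R) = signedLap Q + ε • signedLap R := by
  ext a b
  by_cases h : a = b
  · simp [signedLap, h, Finset.sum_add_distrib, ← Finset.mul_sum]; ring
  · simp [signedLap, h]; ring

theorem isSymm_signedLap {d : ℕ} {Q : Matrix (Fin d) (Fin d) ℝ} (hQ : Q.IsSymm) :
    (signedLap Q).IsSymm :=
  (Matrix.isSymm_diagonal _).sub hQ

theorem coloredQ_add_smul {d r : ℕ} (E : Finset (Fin d × Fin d)) (lam : Fin d × Fin d → Fin r)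
    (ω η : Fin r → ℝ) (ε : ℝ) :
    coloredQ E lam (ω + ε • η) = coloredQ E lam ω + ε • coloredQ E lam η := by
  ext a b
  simp only [coloredQ, Matrix.of_apply, Matrix.add_apply, Matrix.smul_apply]
  split_ifs <;> simp

theorem coloredQ_apply_eq_add {d r : ℕ} {E : Finset (Fin d × Fin d)}
    (hE : ∀ e ∈ E, e.1 < e.2) (lam : Fin d × Fin d → Fin r) (ω : Fin r → ℝ) (a b : Fin d) :
    coloredQ E lam ω a b = (if (a, b) ∈ E then ω (lam (a, b)) else 0) +
      (if (b, a) ∈ E then ω (lam (b, a)) else 0) := by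
  have : (a, b) ∈ E → (b, a) ∉ E := fun h h' => lt_asymm (hE _ h) (hE _ h')
  simp only [coloredQ, Matrix.of_apply]
  split_ifs <;> simp_all

theorem diag_coloredQ {d r : ℕ} {E : Finset (Fin d × Fin d)}
    (hE : ∀ e ∈ E, e.1 < e.2) (lam : Fin d × Fin d → Fin r) (ω : Fin r → ℝ) :
    (coloredQ E lam ω).diag = 0 := by
  ext a
  have : (a, a) ∉ E := fun h => lt_irrefl a (hE _ h)
  simp [coloredQ, this]

theorem isSymm_coloredQ {d r : ℕ} {E : Finset (Fin d × Fin d)}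
    (hE : ∀ e ∈ E, e.1 < e.2) (lam : Fin d × Fin d → Fin r) (ω : Fin r → ℝ) :
    (coloredQ E lam ω).IsSymm := by
  ext a b
  rw [Matrix.transpose_apply, coloredQ_apply_eq_add hE, coloredQ_apply_eq_add hE, add_comm]

/-- The bilinear form of the colored signed Laplacian is a weighted sum over edges. -/
theorem dotProduct_signedLap_coloredQ_mulVec {d r : ℕ} {E : Finset (Fin d × Fin d)}
    (hE : ∀ e ∈ E, e.1 < e.2) (lam : Fin d × Fin d → Fin r) (ω : Fin r → ℝ)
    (x y : Fin d → ℝ) :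
    x ⬝ᵥ signedLap (coloredQ E lam ω) *ᵥ y =
      ∑ f ∈ E, ω (lam f) * ((x f.1 - x f.2) * (y f.1 - y f.2)) := by
  set q : Fin d → Fin d → ℝ := fun a b => if (a, b) ∈ E then ω (lam (a, b)) else 0 with hq
  calc x ⬝ᵥ signedLap (coloredQ E lam ω) *ᵥ y
      = ∑ a, ∑ b, (q a b * (x a * (y a - y b)) + q b a * (x a * (y a - y b))) := by
        simp only [dotProduct, signedLap_mulVec_apply (diag_coloredQ hE lam ω), Finset.mul_sum]
        refine Finset.sum_congr rfl fun a _ => Finset.sum_congr rfl fun b _ => ?_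
        rw [coloredQ_apply_eq_add hE]
        ring
    _ = ∑ a, ∑ b, q a b * ((x a - x b) * (y a - y b)) := by
        simp only [Finset.sum_add_distrib]
        rw [Finset.sum_comm (f := fun a b => q b a * (x a * (y a - y b)))]
        simp only [← Finset.sum_add_distrib]
        refine Finset.sum_congr rfl fun a _ => Finset.sum_congr rfl fun b _ => ?_
        ring
    _ = ∑ f ∈ E, ω (lam f) * ((x f.1 - x f.2) * (y f.1 - y f.2)) := by
        rw [← Fintype.sum_prod_type' (f := fun a b => q a b * ((x a - x b) * (y a - y b)))]
        simp [hq, Finset.sum_ite_mem]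

/-- A symmetric signed Laplacian of rank `d - 1` becomes invertible after adding the
projection onto the constant vectors. -/
theorem isUnit_signedLap_add {d : ℕ} (hd : d ≠ 0) {Q : Matrix (Fin d) (Fin d) ℝ}
    (hQ : Q.IsSymm) (hdiag : Q.diag = 0) (hrank : (signedLap Q).rank = d - 1) :
    IsUnit (signedLap Q + (d : ℝ)⁻¹ • Matrix.vecMulVec 1 1) := by
  have hd' : (d : ℝ) ≠ 0 := Nat.cast_ne_zero.mpr hd
  have hone : signedLap Q *ᵥ 1 = 0 := by
    ext a
    simp [signedLap_mulVec_apply hdiag]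
  have hone' : 1 ᵥ* signedLap Q = 0 := by
    rw [← Matrix.mulVec_transpose, isSymm_signedLap hQ, hone]
  have hker : Module.finrank ℝ (signedLap Q).mulVecLin.ker = 1 := by
    have h := (signedLap Q).mulVecLin.finrank_range_add_finrank_ker
    rw [← Matrix.rank, hrank, Module.finrank_fin_fun] at h
    omega
  rw [← Matrix.mulVec_injective_iff_isUnit]
  refine (injective_iff_map_eq_zero (Matrix.mulVecLin _)).mpr fun x hx => ?_
  rw [Matrix.mulVecLin_apply, Matrix.add_mulVec, Matrix.smul_mulVec,
    Matrix.vecMulVec_mulVec] at hx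
  have hsum : (1 : Fin d → ℝ) ⬝ᵥ x = 0 := by
    have h := congrArg (fun y => (1 : Fin d → ℝ) ⬝ᵥ y) hx
    simpa [dotProduct_add, Matrix.dotProduct_mulVec, hone', hd'] using h
  have hx0 : signedLap Q *ᵥ x = 0 := by simpa [hsum] using hx
  have hne : (⟨1, hone⟩ : (signedLap Q).mulVecLin.ker) ≠ 0 := fun h => by
    have := congrFun (congrArg Subtype.val h) ⟨0, Nat.pos_of_ne_zero hd⟩
    simp at this
  obtain ⟨c, hc⟩ := (finrank_eq_one_iff_of_nonzero' _ hne).mp hker ⟨x, hx0⟩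
  have hc' : c • (1 : Fin d → ℝ) = x := congrArg Subtype.val hc
  subst hc'
  have : c = 0 := by simpa [hd'] using hsum
  simp [this]


/-- in the colored (RCON) signed Laplacian-constrained Gaussian graphical
model, the partial derivative at `ω₀` of `ω ↦ ∑_{uv ∈ E : λ(uv)=i} Γ(ω)_{uv}` with
respect to `ω_j` exists and equals
`-(1/4) ∑_{uv : λ=i} ∑_{st : λ=j} (Γ_{sv} - Γ_{us} - Γ_{tv} + Γ_{ut})²`; consequently
the derivative of the score `S_i` in direction `ω_j` is the negative of
`I(ω)_{ij} = (1/8) ∑∑ (Γ_{sv} - Γ_{us} - Γ_{tv} + Γ_{ut})²`. -/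
theorem statement9 {d r : ℕ} (hd : 2 ≤ d)
    (E : Finset (Fin d × Fin d)) (hE : ∀ e ∈ E, e.1 < e.2)
    (lam : Fin d × Fin d → Fin r) (ω₀ : Fin r → ℝ)
    (hrank : (signedLap (coloredQ E lam ω₀)).rank = d - 1)
    (i j : Fin r) :
    HasDerivAt
      (fun ε : ℝ => ∑ e ∈ E.filter (fun e => lam e = i),
        coloredGamma E lam (ω₀ + ε • (Pi.single j 1 : Fin r → ℝ)) e.1 e.2)
      (-(1 / 4) * ∑ e ∈ E.filter (fun e => lam e = i), ∑ f ∈ E.filter (fun f => lam f = j),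
        infoTerm (coloredGamma E lam ω₀) e f) 0 ∧
    ∀ Γtilde : Matrix (Fin d) (Fin d) ℝ,
      HasDerivAt
        (fun ε : ℝ => (1 / 2) * ∑ e ∈ E.filter (fun e => lam e = i),
          (coloredGamma E lam (ω₀ + ε • (Pi.single j 1 : Fin r → ℝ)) e.1 e.2 - Γtilde e.1 e.2))
        (-((1 / 8) * ∑ e ∈ E.filter (fun e => lam e = i),
            ∑ f ∈ E.filter (fun f => lam f = j),
          infoTerm (coloredGamma E lam ω₀) e f)) 0 := by
  set J : Matrix (Fin d) (Fin d) ℝ := (d : ℝ)⁻¹ • Matrix.vecMulVec 1 1 with hJ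
  set A := signedLap (coloredQ E lam ω₀) + J with hA
  set L := signedLap (coloredQ E lam (Pi.single j 1)) with hL
  have hsymmQ := isSymm_coloredQ hE lam ω₀
  have hunit : IsUnit A := isUnit_signedLap_add (by omega) hsymmQ (diag_coloredQ hE lam ω₀) hrank
  have hJ_apply (a b : Fin d) : J a b = (d : ℝ)⁻¹ := by simp [hJ]
  have hAsymm : A.IsSymm := (isSymm_signedLap hsymmQ).add (by ext a b; simp [hJ_apply])
  have hsymm (a b : Fin d) : A⁻¹ a b = A⁻¹ b a := by
    have : (A⁻¹).IsSymm := by rw [Matrix.IsSymm, Matrix.transpose_nonsing_inv, hAsymm]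
    exact this.apply b a
  have hprod (a b : Fin d) : (A⁻¹ * L * A⁻¹) a b =
      ∑ f ∈ E.filter (fun f => lam f = j),
        (A⁻¹ a f.1 - A⁻¹ a f.2) * (A⁻¹ b f.1 - A⁻¹ b f.2) := by
    have h : (A⁻¹ * L * A⁻¹) a b = A⁻¹ a ⬝ᵥ L *ᵥ A⁻¹ b := by
      rw [mul_assoc, Matrix.mul_apply']
      congr 1
      ext c
      simp only [Matrix.mul_apply, Matrix.mulVec, dotProduct, hsymm _ b]
    rw [h, hL, dotProduct_signedLap_coloredQ_mulVec hE, Finset.sum_filter]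
    refine Finset.sum_congr rfl fun f _ => ?_
    simp [Pi.single_apply]
  have hgamma (ε : ℝ) (a b : Fin d) :
      coloredGamma E lam (ω₀ + ε • (Pi.single j 1 : Fin r → ℝ)) a b =
        (A + ε • L)⁻¹ a a + (A + ε • L)⁻¹ b b - 2 * (A + ε • L)⁻¹ a b := by
    have : signedLap (coloredQ E lam (ω₀ + ε • (Pi.single j 1 : Fin r → ℝ))) + J = A + ε • L := by
      rw [coloredQ_add_smul, signedLap_add_smul, hA, hL]
      abel
    simp only [coloredGamma, vario, lapPinv, ← hJ, this, Matrix.of_apply, Matrix.sub_apply,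
      hJ_apply]
    ring
  have hgamma₀ (a b : Fin d) :
      coloredGamma E lam ω₀ a b = A⁻¹ a a + A⁻¹ b b - 2 * A⁻¹ a b := by
    simpa using hgamma 0 a b
  have hedge (e : Fin d × Fin d) :
      HasDerivAt (fun ε : ℝ => coloredGamma E lam (ω₀ + ε • (Pi.single j 1 : Fin r → ℝ)) e.1 e.2)
        (-(1 / 4) * ∑ f ∈ E.filter (fun f => lam f = j),
          infoTerm (coloredGamma E lam ω₀) e f) 0 := by
    have hderiv := hasDerivAt_inv_add_smul_apply hunit L
    simp only [hgamma]
    refine (((hderiv e.1 e.1).add (hderiv e.2 e.2)).sub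
      ((hderiv e.1 e.2).const_mul 2)).congr_deriv ?_
    simp only [hprod, Finset.mul_sum, ← Finset.sum_neg_distrib,
      ← Finset.sum_add_distrib, ← Finset.sum_sub_distrib]
    refine Finset.sum_congr rfl fun f _ => ?_
    simp only [infoTerm, hgamma₀, hsymm f.1 e.2, hsymm f.2 e.2]
    ring
  have hsum := HasDerivAt.fun_sum (u := E.filter (fun e => lam e = i)) fun e _ => hedge e
  rw [← Finset.mul_sum] at hsum
  refine ⟨hsum, fun Γtilde => ?_⟩
  simp only [Finset.sum_sub_distrib]
  refine ((hsum.sub_const (∑ e ∈ E.filter (fun e => lam e = i), Γtilde e.1 e.2)).const_mul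
    (1 / 2 : ℝ)).congr_deriv ?_
  ring
end
end
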